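/- arXiv:1206.0225 — 2 statements merged into one kernel-verified Lean document; each statement's English description precedes it below -/
import Mathlib

section
/- Let Ψ_{k,t} : ℂ^k → ℂ^k be the map whose j-th component is t₁z₁^j + t₂z₂^j + ⋯ + t_k z_k^j, where t = (t₁,…,t_k) has all t_i > 0. Then the topological (Brouwer) degree of Ψ_{k,t} relative to the ball B_R^{(k)} = {z ∈ ℂ^k : |z₁|² + ⋯ + |z_k|² < R²} with respect to 0 equals k!, for every R > 0. -/
open Set

/-- An (axiomatic) Brouwer degree theory for continuous maps of `ℂ^k ≃ ℝ^{2k}`,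
relative to bounded open sets, with respect to a point: normalization, additivity,
homotopy invariance and the solution property. The Brouwer degree is the unique
such theory. -/
structure DegreeTheory (k : ℕ) where
  deg : ((Fin k → ℂ) → (Fin k → ℂ)) → Set (Fin k → ℂ) → (Fin k → ℂ) → ℤ
  normalization : ∀ (U : Set (Fin k → ℂ)) (y : Fin k → ℂ),
    IsOpen U → Bornology.IsBounded U → y ∈ U → deg id U y = 1
  additivity : ∀ (f : (Fin k → ℂ) → (Fin k → ℂ)) (U U₁ U₂ : Set (Fin k → ℂ))
    (y : Fin k → ℂ), IsOpen U → Bornology.IsBounded U → IsOpen U₁ → IsOpen U₂ →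
    Disjoint U₁ U₂ → U₁ ∪ U₂ ⊆ U → Continuous f →
    (∀ x ∈ closure U \ (U₁ ∪ U₂), f x ≠ y) →
    deg f U y = deg f U₁ y + deg f U₂ y
  homotopy_invariance : ∀ (H : ℝ → (Fin k → ℂ) → (Fin k → ℂ))
    (U : Set (Fin k → ℂ)) (y : Fin k → ℂ),
    IsOpen U → Bornology.IsBounded U →
    Continuous (fun p : ℝ × (Fin k → ℂ) => H p.1 p.2) →
    (∀ t ∈ Icc (0:ℝ) 1, ∀ x ∈ frontier U, H t x ≠ y) →
    deg (H 0) U y = deg (H 1) U y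
  solution : ∀ (f : (Fin k → ℂ) → (Fin k → ℂ)) (U : Set (Fin k → ℂ))
    (y : Fin k → ℂ), IsOpen U → Bornology.IsBounded U → Continuous f →
    (∀ x ∈ frontier U, f x ≠ y) → deg f U y ≠ 0 → ∃ x ∈ U, f x = y

namespace DegAux

variable {k : ℕ}

theorem deg_empty (D : DegreeTheory k) (f : (Fin k → ℂ) → (Fin k → ℂ)) (hf : Continuous f) :
    D.deg f ∅ 0 = 0 := by
  have h := D.additivity f ∅ ∅ ∅ 0 isOpen_empty Bornology.isBounded_empty isOpen_empty
    isOpen_empty (by simp) (by simp) hf (by simp)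
  linarith

theorem deg_excision (D : DegreeTheory k) (f : (Fin k → ℂ) → (Fin k → ℂ)) (hf : Continuous f)
    (U V : Set (Fin k → ℂ)) (hU : IsOpen U) (hb : Bornology.IsBounded U) (hV : IsOpen V)
    (hVU : V ⊆ U) (h : ∀ x ∈ closure U, f x = 0 → x ∈ V) :
    D.deg f U 0 = D.deg f V 0 := by
  have h := D.additivity f U V ∅ 0 hU hb hV isOpen_empty (by simp) (by simpa using hVU) hf (by
    rintro x ⟨hx, hx'⟩ h0
    exact hx' (Or.inl (h x hx h0)))
  rw [h, deg_empty D f hf, add_zero]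

theorem deg_translate (D : DegreeTheory k) (a : Fin k → ℂ) (U : Set (Fin k → ℂ))
    (hU : IsOpen U) (hb : Bornology.IsBounded U) (ha : a ∈ U) :
    D.deg (fun x => x - a) U 0 = 1 := by
  obtain ⟨r, hr, hUr⟩ := hb.subset_ball_lt 0 0
  have h1 : D.deg (fun x => x - a) (Metric.ball 0 r) 0 = D.deg (fun x => x - a) U 0 := by
    apply deg_excision D _ (by fun_prop) _ _ Metric.isOpen_ball Metric.isBounded_ball hU hUr
    intro x _ hx
    rwa [sub_eq_zero.1 hx]
  rw [← h1]
  have h2 := D.homotopy_invariance (fun s x => x - (s : ℂ) • a) (Metric.ball 0 r) 0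
    Metric.isOpen_ball Metric.isBounded_ball (by fun_prop) (by
      intro s hs x hx h0
      have hx' : x ∉ Metric.ball (0 : Fin k → ℂ) r := by
        rw [Metric.isOpen_ball.frontier_eq] at hx
        exact hx.2
      apply hx'
      rw [sub_eq_zero.1 h0]
      have har := hUr ha
      simp only [mem_ball_zero_iff] at har ⊢
      rw [norm_smul, Complex.norm_real, Real.norm_of_nonneg hs.1]
      nlinarith [norm_nonneg a, hs.2])
  have h3 := D.normalization (Metric.ball 0 r) 0 Metric.isOpen_ball Metric.isBounded_ball
    (by simpa using hr)
  have e0 : (fun x : Fin k → ℂ => x - ((0 : ℝ) : ℂ) • a) = id := by ext; simp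
  have e1 : (fun x : Fin k → ℂ => x - ((1 : ℝ) : ℂ) • a) = (fun x => x - a) := by ext; simp
  simp only [e0, e1] at h2
  rw [← h2, h3]

theorem deg_linear (D : DegreeTheory k) (A : (Fin k → ℂ) →L[ℂ] (Fin k → ℂ))
    (hA : Function.Injective A) (a : Fin k → ℂ) (U : Set (Fin k → ℂ))
    (hU : IsOpen U) (hb : Bornology.IsBounded U) (ha : a ∈ U) :
    D.deg (fun x => A (x - a)) U 0 = 1 := by
  let L : Module.End ℂ (Fin k → ℂ) := A.toLinearMap
  let S : Set ℂ := {z | ∃ v : Fin k → ℂ, v ≠ 0 ∧ (1 - z) • v + z • A v = 0}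
  have hS : S ⊆ (fun μ : ℂ => (1 - μ)⁻¹) '' {μ | L.HasEigenvalue μ} := by
    rintro z ⟨v, hv, hz⟩
    have hz0 : z ≠ 0 := by
      rintro rfl
      simp at hz
      exact hv hz
    refine ⟨1 - z⁻¹, ?_, by simp⟩
    refine Module.End.hasEigenvalue_of_hasEigenvector (x := v) ?_
    refine Module.End.hasEigenvector_iff.2 ⟨Module.End.mem_eigenspace_iff.2 ?_, hv⟩
    change A v = _
    have h1 : z • A v = (z - 1) • v := by
      rw [eq_comm, ← sub_eq_zero, ← neg_eq_zero, ← hz]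
      module
    have h2 : A v = z⁻¹ • (z • A v) := by rw [smul_smul, inv_mul_cancel₀ hz0, one_smul]
    rw [h2, h1, smul_smul]
    congr 1
    field_simp
  have hfin : S.Countable :=
    (((Module.End.finite_hasEigenvalue L).image _).subset hS).countable
  have hpc : IsPathConnected Sᶜ := by
    apply hfin.isPathConnected_compl_of_one_lt_rank
    rw [Complex.rank_real_complex]
    norm_num
  have h0 : (0 : ℂ) ∈ Sᶜ := by
    rintro ⟨v, hv, h⟩
    simp at h
    exact hv h
  have h1 : (1 : ℂ) ∈ Sᶜ := by
    rintro ⟨v, hv, h⟩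
    simp at h
    exact hv (hA (by simpa using h))
  have hJ := hpc.joinedIn 0 h0 1 h1
  let γ := hJ.somePath
  have hγ : Continuous γ.extend := γ.continuous_extend
  have key := D.homotopy_invariance
    (fun s x => (1 - γ.extend s) • (x - a) + γ.extend s • A (x - a)) U 0 hU hb (by fun_prop) (by
      intro s hs x hx he
      have hm : γ.extend s ∈ Sᶜ := by
        rw [Path.extend_apply _ hs]
        exact hJ.somePath_mem _
      apply hm
      refine ⟨x - a, ?_, he⟩
      intro h
      rw [hU.frontier_eq] at hx
      apply hx.2
      rwa [sub_eq_zero.1 h])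
  have e0 : γ.extend 0 = 0 := γ.extend_zero
  have e1 : γ.extend 1 = 1 := γ.extend_one
  simp only [e0, e1, sub_zero, one_smul, zero_smul, add_zero, sub_self, zero_add] at key
  rw [← key]
  exact deg_translate D a U hU hb ha

theorem deg_local (D : DegreeTheory k) (f : (Fin k → ℂ) → (Fin k → ℂ)) (hf : Continuous f)
    (A : (Fin k → ℂ) →L[ℂ] (Fin k → ℂ)) (hA : Function.Injective A) (a : Fin k → ℂ)
    (hfa : f a = 0) (hd : HasFDerivAt f A a) :
    ∃ δ > (0 : ℝ), ∀ ε : ℝ, 0 < ε → ε < δ → D.deg f (Metric.ball a ε) 0 = 1 := by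
  obtain ⟨K, hK, hKA⟩ := LinearMap.exists_antilipschitzWith A.toLinearMap
    (LinearMap.ker_eq_bot.2 hA)
  have hK' : (0 : ℝ) < K := hK
  have hc : (0 : ℝ) < (2 * (K : ℝ))⁻¹ := by positivity
  have hlo := (hasFDerivAt_iff_isLittleO.1 hd).def hc
  obtain ⟨δ, hδ, hball⟩ := Metric.eventually_nhds_iff.1 hlo
  refine ⟨δ, hδ, fun ε hε hεδ => ?_⟩
  rw [← deg_linear D A hA a (Metric.ball a ε) Metric.isOpen_ball Metric.isBounded_ball
    (Metric.mem_ball_self hε)]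
  have key := D.homotopy_invariance
    (fun s x => A (x - a) + ((1 - s : ℝ) : ℂ) • (f x - A (x - a))) (Metric.ball a ε) 0
    Metric.isOpen_ball Metric.isBounded_ball (by fun_prop) (by
      intro s hs x hx he
      have hx1 := Metric.frontier_ball_subset_sphere hx
      have hxe : dist x a = ε := hx1
      have h1 := hball (show dist x a < δ by linarith)
      rw [hfa, sub_zero] at h1
      have h2 : ‖x - a‖ ≤ K * ‖A (x - a)‖ := by
        have := hKA.le_mul_dist (x - a) 0
        simpa using this
      have h3 : ‖A (x - a)‖ ≤ ‖f x - A (x - a)‖ := by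
        have h6 := congrArg norm (eq_neg_of_add_eq_zero_left he)
        rw [norm_neg, norm_smul, Complex.norm_real,
          Real.norm_of_nonneg (by linarith [hs.2])] at h6
        nlinarith [norm_nonneg (f x - A (x - a)), hs.1]
      rw [dist_eq_norm] at hxe
      rw [hxe] at h1 h2
      have h4 : ε ≤ K * ((2 * (K : ℝ))⁻¹ * ε) := h2.trans (by gcongr; linarith)
      have h5 : (K : ℝ) * ((2 * (K : ℝ))⁻¹ * ε) = ε / 2 := by field_simp
      linarith)
  simpa using key

theorem deg_count (D : DegreeTheory k) (f : (Fin k → ℂ) → (Fin k → ℂ)) (hf : Continuous f)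
    (S : Finset (Fin k → ℂ))
    (hS : ∀ a ∈ S, ∃ δ > (0 : ℝ), ∀ ε : ℝ, 0 < ε → ε < δ → D.deg f (Metric.ball a ε) 0 = 1) :
    ∀ U : Set (Fin k → ℂ), IsOpen U → Bornology.IsBounded U → (∀ a ∈ S, a ∈ U) →
      (∀ x ∈ closure U, f x = 0 → x ∈ S) → D.deg f U 0 = S.card := by
  classical
  induction S using Finset.induction_on with
  | empty =>
    intro U hU hb _ hz
    rw [deg_excision D f hf U ∅ hU hb isOpen_empty (by simp)
      (fun x hx h0 => by simpa using hz x hx h0), deg_empty D f hf]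
    simp
  | insert a S haS ih =>
    intro U hU hb hSU hz
    obtain ⟨δ, hδ, hdeg⟩ := hS a (by simp)
    have hopen : IsOpen (U ∩ (S : Set (Fin k → ℂ))ᶜ) :=
      hU.inter S.finite_toSet.isClosed.isOpen_compl
    obtain ⟨r, hr, hrU⟩ := Metric.isOpen_iff.1 hopen a ⟨hSU a (by simp), by simpa using haS⟩
    obtain ⟨ε, hε, hεm⟩ := exists_between (lt_min hδ hr)
    have hεδ := hεm.trans_le (min_le_left _ _)
    have hεr := hεm.trans_le (min_le_right _ _)
    have hcb : Metric.closedBall a ε ⊆ U ∩ (S : Set (Fin k → ℂ))ᶜ :=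
      (Metric.closedBall_subset_ball hεr).trans hrU
    have hU2 : IsOpen (U \ Metric.closedBall a ε) := hU.sdiff Metric.isClosed_closedBall
    rw [D.additivity f U (Metric.ball a ε) (U \ Metric.closedBall a ε) 0 hU hb
      Metric.isOpen_ball hU2 ?_ ?_ hf ?_, hdeg ε hε hεδ,
      ih (fun b hb => hS b (by simp [hb])) _ hU2 (hb.subset sdiff_subset) ?_ ?_,
      Finset.card_insert_of_notMem haS]
    · push_cast; ring
    · intro b hb'
      exact ⟨hSU b (by simp [hb']), fun h => (hcb h).2 hb'⟩
    · intro x hx h0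
      have hx1 := hz x (closure_mono sdiff_subset hx) h0
      rcases Finset.mem_insert.1 hx1 with rfl | h
      · exfalso
        have : closure (U \ Metric.closedBall x ε) ⊆ (Metric.ball x ε)ᶜ :=
          closure_minimal (fun y hy h => hy.2 (Metric.ball_subset_closedBall h))
            Metric.isOpen_ball.isClosed_compl
        exact this hx (Metric.mem_ball_self hε)
      · exact h
    · rw [Set.disjoint_left]
      intro y hy hy2
      exact hy2.2 (Metric.ball_subset_closedBall hy)
    · exact union_subset (Metric.ball_subset_closedBall.trans (hcb.trans inter_subset_left))
        sdiff_subset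
    · rintro x ⟨hx, hx'⟩ h0
      apply hx'
      rcases Finset.mem_insert.1 (hz x hx h0) with rfl | h
      · exact Or.inl (Metric.mem_ball_self hε)
      · exact Or.inr ⟨hSU x (by simp [h]), fun h' => (hcb h').2 h⟩

/-- The only zero of the weighted power sum map is the origin. -/
theorem zero_unique (t : Fin k → ℝ) (ht : ∀ i, 0 < t i) (z : Fin k → ℂ)
    (h : ∀ j : Fin k, ∑ i, (t i : ℂ) * z i ^ ((j : ℕ) + 1) = 0) : z = 0 := by
  classical
  by_contra hz
  obtain ⟨a, ha⟩ : ∃ a, z a ≠ 0 := by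
    by_contra! hc
    exact hz (funext hc)
  let V : Finset ℂ := ((Finset.univ.image z).erase 0).erase (z a)
  let q : Polynomial ℂ := ∏ v ∈ V, (Polynomial.X - Polynomial.C v)
  have hV : V.card + 1 ≤ k := by
    have h1 : z a ∈ (Finset.univ.image z).erase 0 := by simp [ha]
    have h2 : V.card + 1 = ((Finset.univ.image z).erase 0).card :=
      Finset.card_erase_add_one h1
    rw [h2]
    exact (Finset.card_erase_le).trans (Finset.card_image_le.trans (by simp))
  have hq : q.natDegree < k := by
    have : q.natDegree = V.card := Polynomial.natDegree_finsetProd_X_sub_C_eq_card _ _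
    omega
  have hsum : ∑ i, (t i : ℂ) * (z i * q.eval (z i)) = 0 := by
    simp_rw [Polynomial.eval_eq_sum_range' hq, Finset.mul_sum]
    rw [Finset.sum_comm]
    apply Finset.sum_eq_zero
    intro j hj
    have := h ⟨j, Finset.mem_range.1 hj⟩
    calc _ = q.coeff j * ∑ i, (t i : ℂ) * z i ^ (j + 1) := by
          rw [Finset.mul_sum]
          exact Finset.sum_congr rfl fun i _ => by ring
      _ = 0 := by rw [this, mul_zero]
  have hterm : ∀ i, (t i : ℂ) * (z i * q.eval (z i)) =
      ((if z i = z a then t i else 0 : ℝ) : ℂ) * (z a * q.eval (z a)) := by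
    intro i
    by_cases hi : z i = z a
    · simp [hi]
    · by_cases h0 : z i = 0
      · simp [h0, Ne.symm ha]
      · have : q.eval (z i) = 0 := by
          rw [Polynomial.eval_prod]
          exact Finset.prod_eq_zero (i := z i) (by simp [V, hi, h0]) (by simp)
        simp [hi, this]
  simp_rw [hterm] at hsum
  rw [← Finset.sum_mul, ← Complex.ofReal_sum] at hsum
  have hqa : q.eval (z a) ≠ 0 := by
    rw [Polynomial.eval_prod, Finset.prod_ne_zero_iff]
    intro v hv
    simp only [Polynomial.eval_sub, Polynomial.eval_X, Polynomial.eval_C]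
    intro h0
    rw [sub_eq_zero] at h0
    simp [V, h0] at hv
  have hpos : 0 < ∑ i, (if z i = z a then t i else 0 : ℝ) := by
    apply Finset.sum_pos'
    · intro i _
      split_ifs
      · exact (ht i).le
      · exact le_rfl
    · exact ⟨a, Finset.mem_univ _, by simp [ht a]⟩
  rcases mul_eq_zero.1 hsum with h1 | h1
  · exact hpos.ne' (by exact_mod_cast h1)
  · exact mul_ne_zero ha hqa h1

/-- Equal power sums imply equality up to permutation. -/
theorem perm_of_psum (z w : Fin k → ℂ) (hw : Function.Injective w)
    (h : ∀ j : Fin k, ∑ i, z i ^ ((j : ℕ) + 1) = ∑ i, w i ^ ((j : ℕ) + 1)) :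
    ∃ σ : Equiv.Perm (Fin k), z = w ∘ σ := by
  have hp : ∀ n, 0 < n → n ≤ k → MvPolynomial.aeval z (MvPolynomial.psum (Fin k) ℂ n) =
      MvPolynomial.aeval w (MvPolynomial.psum (Fin k) ℂ n) := by
    intro n hn hnk
    have := h ⟨n - 1, by omega⟩
    have e : n - 1 + 1 = n := by omega
    simpa [MvPolynomial.psum, e] using this
  have he : ∀ n, n ≤ k → MvPolynomial.aeval z (MvPolynomial.esymm (Fin k) ℂ n) =
      MvPolynomial.aeval w (MvPolynomial.esymm (Fin k) ℂ n) := by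
    intro n
    induction n using Nat.strong_induction_on with
    | _ n ih =>
      intro hnk
      rcases Nat.eq_zero_or_pos n with rfl | hn
      · simp
      have hN := MvPolynomial.mul_esymm_eq_sum (Fin k) ℂ n
      have hz := congrArg (MvPolynomial.aeval z) hN
      have hw' := congrArg (MvPolynomial.aeval w) hN
      simp only [map_mul, map_natCast, map_pow, map_neg, map_one, map_sum] at hz hw'
      have hn0 : (n : ℂ) ≠ 0 := by exact_mod_cast hn.ne'
      apply mul_left_cancel₀ hn0
      rw [hz, hw']
      congr 1
      apply Finset.sum_congr rfl
      intro a ha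
      have ha' := Finset.mem_filter.1 ha
      have ha2 := Finset.HasAntidiagonal.mem_antidiagonal.1 ha'.1
      have ha := ha'.2
      rw [ih a.1 ha (by omega), hp a.2 (by omega) (by omega)]
  have hms : Multiset.map z Finset.univ.val = Multiset.map w Finset.univ.val := by
    rw [← Polynomial.roots_multiset_prod_X_sub_C (Multiset.map z Finset.univ.val),
      ← Polynomial.roots_multiset_prod_X_sub_C (Multiset.map w Finset.univ.val)]
    congr 1
    rw [Multiset.prod_X_sub_X_eq_sum_esymm, Multiset.prod_X_sub_X_eq_sum_esymm]
    simp only [Multiset.card_map, Finset.card_val, Finset.card_univ, Fintype.card_fin]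
    apply Finset.sum_congr rfl
    intro j hj
    have := he j (by simpa [Nat.lt_succ_iff] using hj)
    rw [MvPolynomial.aeval_esymm_eq_multiset_esymm,
      MvPolynomial.aeval_esymm_eq_multiset_esymm] at this
    rw [this]
  have hzi : Function.Injective z := by
    have h1 : (Multiset.map z Finset.univ.val).Nodup := by
      rw [hms]
      exact Finset.univ.nodup.map hw
    intro a b hab
    exact Multiset.inj_on_of_nodup_map h1 a (Finset.mem_univ a) b (Finset.mem_univ b) hab
  have hex : ∀ i, ∃ j, w j = z i := by
    intro i
    have : z i ∈ Multiset.map w Finset.univ.val := by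
      rw [← hms]
      exact Multiset.mem_map_of_mem z (Finset.mem_univ i)
    obtain ⟨j, -, hj⟩ := Multiset.mem_map.1 this
    exact ⟨j, hj⟩
  choose σ hσ using hex
  have hσi : Function.Injective σ := by
    intro a b hab
    apply hzi
    rw [← hσ a, ← hσ b, hab]
  refine ⟨Equiv.ofBijective σ (Finite.injective_iff_bijective.1 hσi), ?_⟩
  ext i
  simp [hσ]

/-- Derivative of the power sum map. -/
noncomputable def dP (z : Fin k → ℂ) : (Fin k → ℂ) →L[ℂ] (Fin k → ℂ) :=
  ContinuousLinearMap.pi fun j : Fin k =>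
    ∑ i, (((j : ℕ) + 1 : ℂ) * z i ^ (j : ℕ)) • ContinuousLinearMap.proj (R := ℂ) i

theorem hasFDerivAt_P (z c : Fin k → ℂ) :
    HasFDerivAt (fun z : Fin k → ℂ => (fun j : Fin k => ∑ i, z i ^ ((j : ℕ) + 1)) - c)
      (dP z) z := by
  apply HasFDerivAt.sub_const
  rw [hasFDerivAt_pi']
  intro j
  have : (ContinuousLinearMap.proj (R := ℂ) j).comp (dP z) =
      ∑ i, (((j : ℕ) + 1 : ℂ) * z i ^ (j : ℕ)) • ContinuousLinearMap.proj (R := ℂ) i := by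
    ext v
    simp [dP]
  rw [this]
  apply HasFDerivAt.fun_sum
  intro i _
  have h := (hasFDerivAt_apply (𝕜 := ℂ) i z).pow ((j : ℕ) + 1)
  refine h.congr_fderiv ?_
  ext v
  simp

theorem dP_injective (z : Fin k → ℂ) (hz : Function.Injective z) :
    Function.Injective (dP z) := by
  rw [injective_iff_map_eq_zero]
  intro v hv
  apply Matrix.eq_zero_of_forall_pow_sum_mul_pow_eq_zero hz
  intro j
  have h := congrFun hv j
  simp only [dP, ContinuousLinearMap.coe_pi', _root_.sum_apply, Pi.zero_apply,
    _root_.smul_apply, ContinuousLinearMap.proj_apply, smul_eq_mul] at h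
  have hj : ((j : ℕ) + 1 : ℂ) ≠ 0 := by exact_mod_cast Nat.succ_ne_zero (j : ℕ)
  apply mul_left_cancel₀ hj
  rw [mul_zero, ← h, Finset.mul_sum]
  exact Finset.sum_congr rfl fun i _ => by ring

end DegAux

open DegAux

/-- Lemma 3.3 of Bartolucci–Malchiodi (Lemma 3.1 of Bartolucci–De Marchis): the
Brouwer degree of `Ψ_{k,t}(z)_j = Σ_i t_i z_i^j` (with all `t_i > 0`) on the ball
`B_R^{(k)} = {z : Σ_i |z_i|² < R²}` with respect to `0` equals `k!`, for all `R > 0`. -/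
theorem stmt_2 (k : ℕ) (D : DegreeTheory k) (t : Fin k → ℝ) (ht : ∀ i, 0 < t i)
    (R : ℝ) (hR : 0 < R) :
    D.deg (fun z : Fin k → ℂ => fun j : Fin k => ∑ i, (t i : ℂ) * z i ^ ((j : ℕ) + 1))
      {z : Fin k → ℂ | ∑ i, ‖z i‖ ^ 2 < R ^ 2} 0 = (Nat.factorial k : ℤ) := by
  classical
  set U : Set (Fin k → ℂ) := {z : Fin k → ℂ | ∑ i, ‖z i‖ ^ 2 < R ^ 2} with hUdef
  have hU : IsOpen U := isOpen_lt (by fun_prop) continuous_const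
  have hb : Bornology.IsBounded U := by
    refine (Metric.isBounded_closedBall (x := (0 : Fin k → ℂ)) (r := R)).subset ?_
    intro z hz
    rw [mem_closedBall_zero_iff, pi_norm_le_iff_of_nonneg hR.le]
    intro i
    have h1 : ‖z i‖ ^ 2 ≤ ∑ i, ‖z i‖ ^ 2 :=
      Finset.single_le_sum (f := fun i => ‖z i‖ ^ 2) (fun i _ => by positivity)
        (Finset.mem_univ i)
    exact abs_le_of_sq_le_sq' (h1.trans (le_of_lt hz)) hR.le |>.2
  have h0U : (0 : Fin k → ℂ) ∈ U := by
    simp only [hUdef, mem_ofPred_eq, Pi.zero_apply, norm_zero]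
    simpa using by positivity
  have hfr : ∀ x ∈ frontier U, x ≠ 0 := by
    rintro x hx rfl
    rw [hU.frontier_eq] at hx
    exact hx.2 h0U
  let P : (Fin k → ℂ) → (Fin k → ℂ) := fun z j => ∑ i, z i ^ ((j : ℕ) + 1)
  have hP : Continuous P := by fun_prop
  have hP0 : ∀ z, P z = 0 → z = 0 := by
    intro z hz
    apply zero_unique (fun _ => 1) (fun _ => one_pos)
    intro j
    simpa [P] using congrFun hz j
  -- step one: deform the weights to one
  have step1 : D.deg (fun z : Fin k → ℂ => fun j : Fin k =>
      ∑ i, (t i : ℂ) * z i ^ ((j : ℕ) + 1)) U 0 = D.deg P U 0 := by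
    have key := D.homotopy_invariance (fun s z j =>
      ∑ i, (((1 - s) * t i + s : ℝ) : ℂ) * z i ^ ((j : ℕ) + 1)) U 0 hU hb (by fun_prop) (by
        intro s hs x hx he
        apply hfr x hx
        apply zero_unique (fun i => (1 - s) * t i + s)
        · intro i
          have := ht i
          rcases eq_or_lt_of_le hs.1 with rfl | h
          · simpa using this
          · have : 0 ≤ (1 - s) * t i := mul_nonneg (by linarith [hs.2]) this.le
            linarith
        · intro j
          exact congrFun he j)
    simpa [P] using key
  rw [step1]
  -- step two: choose a small regular value
  obtain ⟨δ, hδ, hδP⟩ : ∃ δ > (0 : ℝ), ∀ x ∈ frontier U, δ ≤ ‖P x‖ := by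
    have hc : IsCompact (frontier U) :=
      Metric.isCompact_of_isClosed_isBounded isClosed_frontier
        (hb.closure.subset frontier_subset_closure)
    exact hc.exists_forall_le' (by fun_prop) (a := 0)
      (fun x hx => norm_pos_iff.2 fun h => hfr x hx (hP0 x h))
  let W : ℝ → (Fin k → ℂ) := fun ε i => (ε : ℂ) * ((i : ℕ) + 1)
  have hW : Continuous W := by fun_prop
  have hW0 : W 0 = 0 := by ext; simp [W]
  have hPz : P 0 = 0 := by ext; simp [P]
  have hev : ∀ᶠ ε in nhds (0 : ℝ), ‖P (W ε)‖ < δ ∧ W ε ∈ U := by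
    apply Filter.Eventually.and
    · have hc : Continuous fun ε => ‖P (W ε)‖ := by fun_prop
      exact hc.continuousAt.eventually_lt continuousAt_const (by simpa [hW0, hPz] using hδ)
    · exact hW.continuousAt.eventually (hU.mem_nhds (by rwa [hW0]))
  obtain ⟨ε, ⟨hε1, hε2⟩, hε⟩ : ∃ ε : ℝ, (‖P (W ε)‖ < δ ∧ W ε ∈ U) ∧ 0 < ε :=
    ((hev.filter_mono nhdsWithin_le_nhds).and
      (self_mem_nhdsWithin : Ioi (0 : ℝ) ∈ nhdsWithin 0 (Ioi 0))).exists
  generalize hwdef : W ε = w at hε1 hε2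
  have hw : Function.Injective w := by
    intro a b hab
    rw [← hwdef] at hab
    have hε' : (ε : ℂ) ≠ 0 := by exact_mod_cast hε.ne'
    have := mul_left_cancel₀ hε' hab
    have h2 : ((a : ℕ) : ℂ) = (b : ℕ) := add_right_cancel this
    exact Fin.ext (by exact_mod_cast h2)
  have step2 : D.deg P U 0 = D.deg (fun z => P z - P w) U 0 := by
    have key := D.homotopy_invariance (fun s z => P z - (s : ℂ) • P w) U 0 hU hb (by fun_prop) (by
        intro s hs x hx he
        have h1 := hδP x hx
        rw [sub_eq_zero.1 he, norm_smul, Complex.norm_real, Real.norm_of_nonneg hs.1] at h1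
        nlinarith [norm_nonneg (P w), hs.2])
    simpa using key
  rw [step2]
  let S : Finset (Fin k → ℂ) := Finset.univ.image fun σ : Equiv.Perm (Fin k) => w ∘ σ
  have hScard : S.card = k.factorial := by
    rw [Finset.card_image_of_injective, Finset.card_univ, Fintype.card_perm, Fintype.card_fin]
    intro σ τ h
    ext i
    exact congrArg Fin.val (hw (congrFun h i))
  have hPS : ∀ σ : Equiv.Perm (Fin k), P (w ∘ σ) = P w := by
    intro σ
    ext j
    exact Equiv.sum_comp σ (fun i => w i ^ ((j : ℕ) + 1))
  rw [deg_count D (fun z => P z - P w) (by fun_prop) S ?_ U hU hb ?_ ?_, hScard]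
  · intro a ha
    obtain ⟨σ, -, rfl⟩ := Finset.mem_image.1 ha
    exact deg_local D _ (by fun_prop) (dP (w ∘ σ)) (dP_injective _ (hw.comp σ.injective)) _
      (by simp [hPS]) (hasFDerivAt_P _ _)
  · intro a ha
    obtain ⟨σ, -, rfl⟩ := Finset.mem_image.1 ha
    have : ∑ i, ‖(w ∘ σ) i‖ ^ 2 = ∑ i, ‖w i‖ ^ 2 := Equiv.sum_comp σ (fun i => ‖w i‖ ^ 2)
    rw [hUdef, mem_ofPred_eq, this]
    exact hε2
  · intro x _ hx
    obtain ⟨σ, hσ⟩ := perm_of_psum x w hw (fun j => congrFun (sub_eq_zero.1 hx) j)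
    exact Finset.mem_image.2 ⟨σ, Finset.mem_univ _, hσ.symm⟩
end

section
/- Let u be a C² solution of −Δu = V e^{2u} in the unit ball B ⊂ ℝ², with u = 0 on ∂B, where V(x) = ρ |x|^{2α} / ∫_B |x|^{2α} e^{2u} dx, ρ > 0, α > 0. Then ρ < 4π(1+α). -/
open MeasureTheory Metric Real

/-- The Euclidean Laplacian of a function on `ℝ²`, written as the sum of the
second partial derivatives. -/
noncomputable def lap (u : EuclideanSpace ℝ (Fin 2) → ℝ)
    (x : EuclideanSpace ℝ (Fin 2)) : ℝ :=
  ∑ i : Fin 2,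
    fderiv ℝ (fun y => fderiv ℝ u y (EuclideanSpace.single i 1)) x
      (EuclideanSpace.single i 1)

lemma box_div (f g h : ℝ × ℝ → ℝ)
    (hf : ContinuousOn f (Set.Icc 0 1 ×ˢ Set.Icc (-π) π))
    (hg : ContinuousOn g (Set.Icc 0 1 ×ˢ Set.Icc (-π) π))
    (hh : ContinuousOn h (Set.Icc 0 1 ×ˢ Set.Icc (-π) π))
    (hd : ∀ r ∈ Set.Ioo (0:ℝ) 1, ∀ t ∈ Set.Ioo (-π) π,
      DifferentiableAt ℝ f (r, t) ∧ DifferentiableAt ℝ g (r, t) ∧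
      ∃ A B, HasDerivAt (fun r' => f (r', t)) A r ∧ HasDerivAt (fun t' => g (r, t')) B t ∧
        A + B = h (r, t))
    (hper : ∀ r ∈ Set.Icc (0:ℝ) 1, g (r, π) = g (r, -π))
    (hf0 : ∀ t, f (0, t) = 0) :
    ∫ r in (0:ℝ)..1, ∫ t in (-π)..π, h (r, t) = ∫ t in (-π)..π, f (1, t) := by
  have hpi : (-π) ≤ π := by linarith [pi_pos]
  have key : ∀ r ∈ Set.Ioo (0:ℝ) 1, ∀ t ∈ Set.Ioo (-π) π,
      fderiv ℝ f (r, t) (1, 0) + fderiv ℝ g (r, t) (0, 1) = h (r, t) := by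
    intro r hr t ht
    obtain ⟨h1, h2, A, B, hA, hB, hAB⟩ := hd r hr t ht
    have e1 : HasDerivAt (fun r' : ℝ => (r', t)) ((1:ℝ), (0:ℝ)) r :=
      (hasDerivAt_id r).prodMk (hasDerivAt_const r t)
    have e2 : HasDerivAt (fun t' : ℝ => (r, t')) ((0:ℝ), (1:ℝ)) t :=
      (hasDerivAt_const t r).prodMk (hasDerivAt_id t)
    have h1' := HasFDerivAt.comp_hasDerivAt r (l := f) (f := fun r' : ℝ => (r', t)) h1.hasFDerivAt e1
    have h2' := HasFDerivAt.comp_hasDerivAt t (l := g) (f := fun t' : ℝ => (r, t')) h2.hasFDerivAt e2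
    rw [h1'.unique hA, h2'.unique hB, hAB]
  have hae : (Set.Ioo (0:ℝ) 1 ×ˢ Set.Ioo (-π) π : Set (ℝ × ℝ)) =ᵐ[volume]
      (Set.Icc (0:ℝ) 1 ×ˢ Set.Icc (-π) π : Set (ℝ × ℝ)) :=
    Measure.set_prod_ae_eq Ioo_ae_eq_Icc Ioo_ae_eq_Icc
  have hint : IntegrableOn (fun z => fderiv ℝ f z (1, 0) + fderiv ℝ g z (0, 1))
      (Set.Icc (0:ℝ) 1 ×ˢ Set.Icc (-π) π) := by
    have : IntegrableOn h (Set.Icc (0:ℝ) 1 ×ˢ Set.Icc (-π) π) :=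
      hh.integrableOn_compact (isCompact_Icc.prod isCompact_Icc)
    rw [← integrableOn_congr_set_ae hae] at this ⊢
    refine this.congr_fun ?_ (measurableSet_Ioo.prod measurableSet_Ioo)
    rintro ⟨r, t⟩ ⟨hr, ht⟩
    exact (key r hr t ht).symm
  have main := integral2_divergence_prod_of_hasFDerivAt f g (fderiv ℝ f) (fderiv ℝ g) 0 (-π) 1 π
    (by rwa [Set.uIcc_of_le zero_le_one, Set.uIcc_of_le hpi])
    (by rwa [Set.uIcc_of_le zero_le_one, Set.uIcc_of_le hpi])
    (by
      rw [min_eq_left zero_le_one, max_eq_right zero_le_one, min_eq_left hpi, max_eq_right hpi]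
      rintro ⟨r, t⟩ ⟨hr, ht⟩
      exact (hd r hr t ht).1.hasFDerivAt)
    (by
      rw [min_eq_left zero_le_one, max_eq_right zero_le_one, min_eq_left hpi, max_eq_right hpi]
      rintro ⟨r, t⟩ ⟨hr, ht⟩
      exact (hd r hr t ht).2.1.hasFDerivAt)
    (by rwa [Set.uIcc_of_le zero_le_one, Set.uIcc_of_le hpi])
  have c1 : ∫ r in (0:ℝ)..1, g (r, π) = ∫ r in (0:ℝ)..1, g (r, -π) := by
    apply intervalIntegral.integral_congr
    intro r hr
    rw [Set.uIcc_of_le zero_le_one] at hr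
    exact hper r hr
  rw [c1] at main
  simp only [hf0, sub_self, zero_add, intervalIntegral.integral_zero, sub_zero] at main
  rw [← main]
  rw [intervalIntegral.integral_of_le zero_le_one, intervalIntegral.integral_of_le zero_le_one,
    integral_Ioc_eq_integral_Ioo, integral_Ioc_eq_integral_Ioo]
  refine setIntegral_congr_fun measurableSet_Ioo ?_
  intro r hr
  simp only
  rw [intervalIntegral.integral_of_le hpi, intervalIntegral.integral_of_le hpi,
    integral_Ioc_eq_integral_Ioo, integral_Ioc_eq_integral_Ioo]
  refine setIntegral_congr_fun measurableSet_Ioo ?_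
  intro t ht
  exact (key r hr t ht).symm

lemma core (U P Q : ℝ × ℝ → ℝ) (l α ρ : ℝ) (hl : 0 < l) (hα : 0 < α) (hρ : 0 < ρ)
    (hU : ContinuousOn U (Set.Icc 0 1 ×ˢ Set.Icc (-π) π))
    (hP : ContinuousOn P (Set.Icc 0 1 ×ˢ Set.Icc (-π) π))
    (hQ : ContinuousOn Q (Set.Icc 0 1 ×ˢ Set.Icc (-π) π))
    (hd : ∀ r ∈ Set.Ioo (0:ℝ) 1, ∀ t ∈ Set.Ioo (-π) π,
      DifferentiableAt ℝ U (r, t) ∧ DifferentiableAt ℝ P (r, t) ∧ DifferentiableAt ℝ Q (r, t) ∧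
      ∃ a b d, HasDerivAt (fun r' => P (r', t)) (a * cos t + b * sin t) r ∧
        HasDerivAt (fun t' => P (r, t')) (r * (-a * sin t + b * cos t)) t ∧
        HasDerivAt (fun r' => Q (r', t)) (b * cos t + d * sin t) r ∧
        HasDerivAt (fun t' => Q (r, t')) (r * (-b * sin t + d * cos t)) t ∧
        HasDerivAt (fun r' => U (r', t)) (P (r, t) * cos t + Q (r, t) * sin t) r ∧
        a + d = -(l * r ^ (2 * α) * exp (2 * U (r, t))))
    (hPper : ∀ r ∈ Set.Icc (0:ℝ) 1, P (r, π) = P (r, -π))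
    (hQper : ∀ r ∈ Set.Icc (0:ℝ) 1, Q (r, π) = Q (r, -π))
    (hU1 : ∀ t, U (1, t) = 0)
    (hT : ∀ t, -P (1, t) * sin t + Q (1, t) * cos t = 0)
    (hmass : ∫ r in (0:ℝ)..1, ∫ t in (-π)..π, l * (r * (r ^ (2 * α) * exp (2 * U (r, t)))) = ρ) :
    ρ < 4 * π * (1 + α) := by
  have hpi : (-π) ≤ π := by linarith [pi_pos]
  have h2α : 0 ≤ 2 * α := by positivity
  have hfst : ContinuousOn (fun z : ℝ × ℝ => z.1) (Set.Icc 0 1 ×ˢ Set.Icc (-π) π) :=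
    continuous_fst.continuousOn
  have hpow : ContinuousOn (fun z : ℝ × ℝ => z.1 ^ (2 * α)) (Set.Icc 0 1 ×ˢ Set.Icc (-π) π) :=
    (continuous_fst.rpow_const (fun _ => Or.inr h2α)).continuousOn
  have hc : ContinuousOn (fun z : ℝ × ℝ => cos z.2) (Set.Icc 0 1 ×ˢ Set.Icc (-π) π) := by fun_prop
  have hs : ContinuousOn (fun z : ℝ × ℝ => sin z.2) (Set.Icc 0 1 ×ˢ Set.Icc (-π) π) := by fun_prop
  -- first identity
  have I1 := box_div (fun z => z.1 * (P z * cos z.2 + Q z * sin z.2))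
    (fun z => -P z * sin z.2 + Q z * cos z.2)
    (fun z => -(l * (z.1 * (z.1 ^ (2 * α) * exp (2 * U z)))))
    (by fun_prop) (by fun_prop) (by fun_prop)
    (by
      intro r hr t ht
      obtain ⟨dU, dP, dQ, a, b, d, h1, h2, h3, h4, h5, h6⟩ := hd r hr t ht
      refine ⟨by fun_prop, by fun_prop, _, _,
        (hasDerivAt_id r).mul ((h1.mul_const (cos t)).add (h3.mul_const (sin t))),
        (h2.neg.mul (hasDerivAt_sin t)).add (h4.mul (hasDerivAt_cos t)), ?_⟩
      simp only [id, Pi.neg_apply]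
      have cs := sin_sq_add_cos_sq t
      linear_combination r * h6 + r * (a + d) * cs)
    (by intro r hr; simp [hPper r hr, hQper r hr])
    (by intro t; simp)
  have I2 := box_div (fun z => (1/2) * z.1 ^ 2 * ((P z * cos z.2 + Q z * sin z.2) ^ 2
        - (-P z * sin z.2 + Q z * cos z.2) ^ 2)
      + (1/2) * l * (z.1 ^ 2 * (z.1 ^ (2 * α) * exp (2 * U z)))
      + (1 + α) * (z.1 * (P z * cos z.2 + Q z * sin z.2)))
    (fun z => z.1 * (P z * cos z.2 + Q z * sin z.2) * (-P z * sin z.2 + Q z * cos z.2)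
      + (1 + α) * (-P z * sin z.2 + Q z * cos z.2))
    (fun z => 0)
    (by fun_prop) (by fun_prop) (by fun_prop)
    (by
      intro r hr t ht
      obtain ⟨dU, dP, dQ, a, b, d, h1, h2, h3, h4, h5, h6⟩ := hd r hr t ht
      have hr0 : r ≠ 0 := hr.1.ne'
      have dpow : DifferentiableAt ℝ (fun z : ℝ × ℝ => z.1 ^ (2 * α)) (r, t) :=
        DifferentiableAt.rpow_const differentiableAt_fst (Or.inl hr0)
      have e1 := (h1.mul_const (cos t)).add (h3.mul_const (sin t))
      have e2 := (h1.neg.mul_const (sin t)).add (h3.mul_const (cos t))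
      have e3 := (h2.mul (hasDerivAt_cos t)).add (h4.mul (hasDerivAt_sin t))
      have e4 := (h2.neg.mul (hasDerivAt_sin t)).add (h4.mul (hasDerivAt_cos t))
      have e5 := (hasDerivAt_rpow_const (x := r) (p := 2 * α) (Or.inl hr0)).mul
        ((h5.const_mul 2).exp)
      have sq := (hasDerivAt_id r).pow 2
      refine ⟨by fun_prop, by fun_prop, _, _,
        (((sq.const_mul (1/2)).mul ((e1.pow 2).sub (e2.pow 2))).add
          ((sq.mul e5).const_mul ((1/2) * l))).add
          (((hasDerivAt_id r).mul e1).const_mul (1 + α)),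
        ((e3.const_mul r).mul e4).add (e4.const_mul (1 + α)), ?_⟩
      have hrp : r ^ (2 * α) = r * r ^ (2 * α - 1) := by
        rw [rpow_sub_one hr0]; field_simp
      simp only [id, Pi.add_apply, Pi.sub_apply, Pi.mul_apply, Pi.neg_apply, Pi.pow_apply]
      rw [hrp] at h6 ⊢
      have cs := sin_sq_add_cos_sq t
      push_cast
      linear_combination (r ^ 2 * (P (r, t) * cos t + Q (r, t) * sin t) + (1 + α) * r) *
        ((a + d) * cs + h6))
    (by intro r hr; simp [hPper r hr, hQper r hr])
    (by intro t; simp)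
  have hPc : ContinuousOn (fun t => P (1, t)) (Set.Icc (-π) π) :=
    hP.comp (by fun_prop) (fun t ht => ⟨by simp, ht⟩)
  have hQc : ContinuousOn (fun t => Q (1, t)) (Set.Icc (-π) π) :=
    hQ.comp (by fun_prop) (fun t ht => ⟨by simp, ht⟩)
  obtain ⟨w, hw⟩ : ∃ w : ℝ → ℝ, w = fun t => P (1, t) * cos t + Q (1, t) * sin t := ⟨_, rfl⟩
  have hwc : ContinuousOn w (Set.uIcc (-π) π) := by
    rw [hw, Set.uIcc_of_le hpi]
    exact (hPc.mul continuous_cos.continuousOn).add (hQc.mul continuous_sin.continuousOn)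
  have hwi : IntervalIntegrable w volume (-π) π := hwc.intervalIntegrable
  have hwi2 : IntervalIntegrable (fun t => w t ^ 2) volume (-π) π := (hwc.pow 2).intervalIntegrable
  have J1 : ∫ t in (-π)..π, w t = -ρ := by
    rw [← hmass]
    simp only [intervalIntegral.integral_neg, one_mul] at I1
    rw [hw]; exact I1.symm
  have J2 : ∫ t in (-π)..π, ((1/2) * w t ^ 2 + (1/2) * l + (1 + α) * w t) = 0 := by
    simp only [intervalIntegral.integral_zero, hT, hU1] at I2
    rw [I2, hw]
    congr 1; ext t; simp
  rw [intervalIntegral.integral_add ((hwi2.const_mul _).add (by simp)) (hwi.const_mul _),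
    intervalIntegral.integral_add (hwi2.const_mul _) (by simp),
    intervalIntegral.integral_const_mul, intervalIntegral.integral_const_mul,
    intervalIntegral.integral_const_mul, J1, intervalIntegral.integral_const, smul_eq_mul] at J2
  have J3 : 0 ≤ ∫ t in (-π)..π, (w t + ρ / (2 * π)) ^ 2 :=
    intervalIntegral.integral_nonneg hpi (fun t _ => sq_nonneg _)
  have J4 : ∫ t in (-π)..π, (w t + ρ / (2 * π)) ^ 2
      = ∫ t in (-π)..π, (w t ^ 2 + (ρ / π) * w t + (ρ / (2 * π)) ^ 2) := by
    congr 1; ext t; field_simp; ring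
  rw [J4, intervalIntegral.integral_add (hwi2.add (hwi.const_mul _)) (by simp),
    intervalIntegral.integral_add hwi2 (hwi.const_mul _),
    intervalIntegral.integral_const_mul, J1,
    intervalIntegral.integral_const, smul_eq_mul] at J3
  generalize (∫ t in (-π)..π, w t ^ 2) = W at *
  have hpp := pi_pos
  have J5 : ρ ^ 2 / (2 * π) ≤ W := by
    have : W + ρ / π * -ρ + (π - -π) * (ρ / (2 * π)) ^ 2 = W - ρ ^ 2 / (2 * π) := by
      field_simp; ring
    linarith
  rw [div_le_iff₀ (by positivity)] at J5
  have J6 : ρ * ρ < 4 * π * (1 + α) * ρ := by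
    have : 0 < l * π ^ 2 := by positivity
    have : W * (2 * π) = 4 * π * (1 + α) * ρ - 4 * (l * π ^ 2) := by
      linear_combination 4 * π * J2
    nlinarith
  exact lt_of_mul_lt_mul_right J6 hρ.le

noncomputable def polX (z : ℝ × ℝ) : EuclideanSpace ℝ (Fin 2) :=
  (z.1 * cos z.2) • EuclideanSpace.single 0 1 + (z.1 * sin z.2) • EuclideanSpace.single 1 1

lemma norm_polX (z : ℝ × ℝ) : ‖polX z‖ = |z.1| := by
  rw [EuclideanSpace.norm_eq, ← Real.sqrt_sq_eq_abs]
  congr 1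
  simp [polX, Fin.sum_univ_two]
  linear_combination z.1 ^ 2 * sin_sq_add_cos_sq z.2

lemma continuous_polX : Continuous polX := by
  unfold polX; fun_prop

lemma polX_r (r t : ℝ) : HasDerivAt (fun r' => polX (r', t))
    (cos t • EuclideanSpace.single 0 1 + sin t • EuclideanSpace.single 1 1) r := by
  have h1 := ((hasDerivAt_id r).mul_const (cos t)).smul_const
    (EuclideanSpace.single (0 : Fin 2) (1:ℝ))
  have h2 := ((hasDerivAt_id r).mul_const (sin t)).smul_const
    (EuclideanSpace.single (1 : Fin 2) (1:ℝ))
  refine (h1.add h2).congr_deriv ?_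
  simp only [one_mul]

lemma polX_t (r t : ℝ) : HasDerivAt (fun t' => polX (r, t'))
    ((r * -sin t) • EuclideanSpace.single 0 1 + (r * cos t) • EuclideanSpace.single 1 1) t := by
  have h1 := ((hasDerivAt_cos t).const_mul r).smul_const
    (EuclideanSpace.single (0 : Fin 2) (1:ℝ))
  have h2 := ((hasDerivAt_sin t).const_mul r).smul_const
    (EuclideanSpace.single (1 : Fin 2) (1:ℝ))
  exact h1.add h2

lemma diff_polX (z : ℝ × ℝ) : DifferentiableAt ℝ polX z := by
  unfold polX; fun_prop

lemma polar_ball (F : EuclideanSpace ℝ (Fin 2) → ℝ) (hF : ContinuousOn F (closedBall 0 1)) :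
    ∫ r in (0:ℝ)..1, ∫ t in (-π)..π, r * F (polX (r, t)) = ∫ y in ball 0 1, F y := by
  have hpi : (-π) ≤ π := by linarith [pi_pos]
  have hmp : MeasurePreserving (fun p : ℝ × ℝ => WithLp.toLp 2 (MeasurableEquiv.finTwoArrow.symm p))
      volume (volume : Measure (EuclideanSpace ℝ (Fin 2))) :=
    (PiLp.volume_preserving_toLp (Fin 2)).comp (volume_preserving_finTwoArrow ℝ).symm
  have hemb : MeasurableEmbedding
      (fun p : ℝ × ℝ => WithLp.toLp 2 (MeasurableEquiv.finTwoArrow.symm p) :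
        ℝ × ℝ → EuclideanSpace ℝ (Fin 2)) :=
    (MeasurableEquiv.toLp 2 (Fin 2 → ℝ)).measurableEmbedding.comp
      (MeasurableEquiv.finTwoArrow.symm).measurableEmbedding
  rw [← integral_indicator measurableSet_ball, ← hmp.integral_comp hemb,
    ← integral_comp_polarCoord_symm]
  have hX : ∀ z : ℝ × ℝ, (WithLp.toLp 2 (MeasurableEquiv.finTwoArrow.symm (polarCoord.symm z)) :
      EuclideanSpace ℝ (Fin 2)) = polX z := by
    intro z
    ext i
    fin_cases i <;> simp [polX, MeasurableEquiv.finTwoArrow, polarCoord_symm_apply]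
  simp only [hX]
  have hsub : (Set.Ioo (0:ℝ) 1 ×ˢ Set.Ioo (-π) π : Set (ℝ × ℝ)) ⊆ polarCoord.target := by
    rintro ⟨r, t⟩ ⟨hr, ht⟩
    rw [polarCoord_target]
    exact ⟨hr.1, ht⟩
  rw [setIntegral_eq_of_subset_of_forall_sdiff_eq_zero polarCoord.open_target.measurableSet hsub]
  · have e : ∫ z in (Set.Ioo (0:ℝ) 1 ×ˢ Set.Ioo (-π) π : Set (ℝ × ℝ)),
          z.1 • (ball (0 : EuclideanSpace ℝ (Fin 2)) 1).indicator F (polX z)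
        = ∫ z in (Set.Ioo (0:ℝ) 1 ×ˢ Set.Ioo (-π) π : Set (ℝ × ℝ)), z.1 * F (polX z) := by
      refine setIntegral_congr_fun (measurableSet_Ioo.prod measurableSet_Ioo) ?_
      rintro ⟨r, t⟩ ⟨hr, ht⟩
      have : polX (r, t) ∈ ball (0 : EuclideanSpace ℝ (Fin 2)) 1 := by
        rw [mem_ball_zero_iff, norm_polX, abs_of_pos hr.1]; exact hr.2
      simp only [Set.indicator_of_mem this, smul_eq_mul]
    rw [e]
    have hc : ContinuousOn (fun z : ℝ × ℝ => z.1 * F (polX z)) (Set.Icc 0 1 ×ˢ Set.Icc (-π) π) := by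
      refine continuous_fst.continuousOn.mul (hF.comp continuous_polX.continuousOn ?_)
      rintro ⟨r, t⟩ ⟨hr, ht⟩
      rw [mem_closedBall_zero_iff, norm_polX, abs_of_nonneg hr.1]; exact hr.2
    have hi : IntegrableOn (fun z : ℝ × ℝ => z.1 * F (polX z))
        (Set.Ioo (0:ℝ) 1 ×ˢ Set.Ioo (-π) π) (volume.prod volume) :=
      (hc.integrableOn_compact (isCompact_Icc.prod isCompact_Icc)).mono_set
        (Set.prod_mono Set.Ioo_subset_Icc_self Set.Ioo_subset_Icc_self)
    rw [Measure.volume_eq_prod, setIntegral_prod _ hi,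
      intervalIntegral.integral_of_le zero_le_one, integral_Ioc_eq_integral_Ioo]
    refine setIntegral_congr_fun measurableSet_Ioo ?_
    intro r hr
    simp only
    rw [intervalIntegral.integral_of_le hpi, integral_Ioc_eq_integral_Ioo]
  · rintro ⟨r, t⟩ ⟨h1, h2⟩
    rw [polarCoord_target] at h1
    have : polX (r, t) ∉ ball (0 : EuclideanSpace ℝ (Fin 2)) 1 := by
      rw [mem_ball_zero_iff, norm_polX, abs_of_pos h1.1]
      intro h
      exact h2 ⟨⟨h1.1, h⟩, h1.2⟩
    simp [Set.indicator_of_notMem this]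

/-- Proposition 5.5 of Bartolucci–Malchiodi: if `u` is a `C²` solution of
`−Δu = ρ |x|^{2α} e^{2u} / ∫_B |x|^{2α} e^{2u}` in the unit ball `B ⊂ ℝ²` with
`u = 0` on `∂B`, where `ρ > 0` and `α > 0`, then necessarily `ρ < 4π(1+α)`. -/
theorem stmt_7 (u : EuclideanSpace ℝ (Fin 2) → ℝ) (ρ α : ℝ)
    (hρ : 0 < ρ) (hα : 0 < α)
    (hreg : ContDiffOn ℝ 2 u (closedBall 0 1))
    (hint : IntegrableOn (fun y => ‖y‖ ^ (2 * α) * exp (2 * u y))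
      (ball (0 : EuclideanSpace ℝ (Fin 2)) 1))
    (heq : ∀ x ∈ ball (0 : EuclideanSpace ℝ (Fin 2)) 1,
      -lap u x = ρ * ‖x‖ ^ (2 * α) * exp (2 * u x) /
        ∫ y in ball (0 : EuclideanSpace ℝ (Fin 2)) 1, ‖y‖ ^ (2 * α) * exp (2 * u y))
    (hbd : ∀ x ∈ sphere (0 : EuclideanSpace ℝ (Fin 2)) 1, u x = 0) :
    ρ < 4 * π * (1 + α) := by

  have huc : UniqueDiffOn ℝ (closedBall (0 : EuclideanSpace ℝ (Fin 2)) 1) := by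
    refine uniqueDiffOn_convex (convex_closedBall _ _) ?_
    exact ⟨0, ball_subset_interior_closedBall (by simp)⟩
  have hDc := hreg.continuousOn_fderivWithin huc (by norm_num)
  have hmaps : Set.MapsTo polX (Set.Icc 0 1 ×ˢ Set.Icc (-π) π)
      (closedBall (0 : EuclideanSpace ℝ (Fin 2)) 1) := by
    rintro ⟨r, t⟩ ⟨hr, ht⟩
    rw [mem_closedBall_zero_iff, norm_polX, abs_of_nonneg hr.1]; exact hr.2
  have hDX := hDc.comp continuous_polX.continuousOn hmaps
  have hFc : ContinuousOn (fun y => ‖y‖ ^ (2 * α) * exp (2 * u y))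
      (closedBall (0 : EuclideanSpace ℝ (Fin 2)) 1) := by
    have := hreg.continuousOn
    refine (continuous_norm.rpow_const (fun _ => Or.inr (by positivity))).continuousOn.mul ?_
    fun_prop
  have hpol := polar_ball _ hFc
  have hIpos : 0 < ∫ y in ball (0 : EuclideanSpace ℝ (Fin 2)) 1,
      ‖y‖ ^ (2 * α) * exp (2 * u y) := by
    rw [setIntegral_pos_iff_support_of_nonneg_ae (Filter.Eventually.of_forall
      (fun y => by positivity)) hint]
    have hsub : ball (0 : EuclideanSpace ℝ (Fin 2)) 1 \ {0} ⊆
        Function.support (fun y : EuclideanSpace ℝ (Fin 2) => ‖y‖ ^ (2 * α) * exp (2 * u y))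
          ∩ ball 0 1 := by
      rintro y ⟨hy, hy0⟩
      refine ⟨?_, hy⟩
      have : 0 < ‖y‖ := norm_pos_iff.mpr hy0
      exact (by positivity : 0 < ‖y‖ ^ (2 * α) * exp (2 * u y)).ne'
    refine lt_of_lt_of_le ?_ (measure_mono hsub)
    rw [measure_sdiff_null (by simp)]
    exact measure_ball_pos _ _ one_pos
  obtain ⟨J, hJ⟩ : ∃ J, J = ∫ y in ball (0 : EuclideanSpace ℝ (Fin 2)) 1,
      ‖y‖ ^ (2 * α) * exp (2 * u y) := ⟨_, rfl⟩
  rw [← hJ] at hpol hIpos heq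
  refine core (fun z => u (polX z))
    (fun z => fderivWithin ℝ u (closedBall 0 1) (polX z) (EuclideanSpace.single 0 1))
    (fun z => fderivWithin ℝ u (closedBall 0 1) (polX z) (EuclideanSpace.single 1 1))
    (ρ / J) α ρ (by positivity) hα hρ
    (hreg.continuousOn.comp continuous_polX.continuousOn hmaps)
    (hDX.clm_apply continuousOn_const) (hDX.clm_apply continuousOn_const)
    ?_ ?_ ?_ ?_ ?_ ?_
  · intro r hr t ht
    have hb : polX (r, t) ∈ ball (0 : EuclideanSpace ℝ (Fin 2)) 1 := by
      rw [mem_ball_zero_iff, norm_polX, abs_of_pos hr.1]; exact hr.2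
    have hcb : closedBall (0 : EuclideanSpace ℝ (Fin 2)) 1 ∈ nhds (polX (r, t)) :=
      Filter.mem_of_superset (isOpen_ball.mem_nhds hb) ball_subset_closedBall
    have hu2 : ContDiffAt ℝ 2 u (polX (r, t)) := hreg.contDiffAt hcb
    have hud : DifferentiableAt ℝ u (polX (r, t)) := hu2.differentiableAt (by norm_num)
    have hDd : DifferentiableAt ℝ (fderiv ℝ u) (polX (r, t)) :=
      (hu2.fderiv_right (m := 1) (by norm_num)).differentiableAt (by norm_num)
    have hsymm : IsSymmSndFDerivAt ℝ u (polX (r, t)) :=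
      hu2.isSymmSndFDerivAt (by simp)
    have hev : fderivWithin ℝ u (closedBall 0 1) =ᶠ[nhds (polX (r, t))] fderiv ℝ u := by
      filter_upwards [isOpen_ball.mem_nhds hb] with y hy
      exact fderivWithin_of_mem_nhds
        (Filter.mem_of_superset (isOpen_ball.mem_nhds hy) ball_subset_closedBall)
    have hD : ∀ v, HasFDerivAt (fun y => fderivWithin ℝ u (closedBall 0 1) y v)
        ((fderiv ℝ (fderiv ℝ u) (polX (r, t))).flip v) (polX (r, t)) := by
      intro v
      have h1 : HasFDerivAt (fun y => fderiv ℝ u y v)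
          ((fderiv ℝ (fderiv ℝ u) (polX (r, t))).flip v) (polX (r, t)) := by
        have := hDd.hasFDerivAt.clm_apply (hasFDerivAt_const v (polX (r, t)))
        simpa using this
      refine h1.congr_of_eventuallyEq ?_
      filter_upwards [hev] with y hy
      rw [hy]
    have hD' : ∀ v, fderiv ℝ (fun y => fderiv ℝ u y v) (polX (r, t))
        = (fderiv ℝ (fderiv ℝ u) (polX (r, t))).flip v := by
      intro v
      have := hDd.hasFDerivAt.clm_apply (hasFDerivAt_const v (polX (r, t)))
      rw [this.fderiv]; simp
    have hPDE := heq _ hb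
    have hlap : lap u (polX (r, t)) =
        fderiv ℝ (fderiv ℝ u) (polX (r, t)) (EuclideanSpace.single 0 1) (EuclideanSpace.single 0 1)
        + fderiv ℝ (fderiv ℝ u) (polX (r, t)) (EuclideanSpace.single 1 1)
          (EuclideanSpace.single 1 1) := by
      simp only [lap, Fin.sum_univ_two, hD', ContinuousLinearMap.flip_apply]
    have hcross := hsymm (EuclideanSpace.single 0 1) (EuclideanSpace.single 1 1)
    have hX := diff_polX (r, t)
    refine ⟨hud.comp _ hX, (hD _).differentiableAt.comp _ hX, (hD _).differentiableAt.comp _ hX,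
      fderiv ℝ (fderiv ℝ u) (polX (r, t)) (EuclideanSpace.single 0 1) (EuclideanSpace.single 0 1),
      fderiv ℝ (fderiv ℝ u) (polX (r, t)) (EuclideanSpace.single 0 1) (EuclideanSpace.single 1 1),
      fderiv ℝ (fderiv ℝ u) (polX (r, t)) (EuclideanSpace.single 1 1) (EuclideanSpace.single 1 1),
      ?_, ?_, ?_, ?_, ?_, ?_⟩
    · refine HasDerivAt.congr_deriv (HasFDerivAt.comp_hasDerivAt r (f := fun r' => polX (r', t)) (hD _) (polX_r r t)) ?_
      simp only [map_add, map_smul, ContinuousLinearMap.flip_apply, smul_eq_mul, ← hcross]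
      ring
    · refine HasDerivAt.congr_deriv (HasFDerivAt.comp_hasDerivAt t (f := fun t' => polX (r, t')) (hD _) (polX_t r t)) ?_
      simp only [map_add, map_smul, ContinuousLinearMap.flip_apply, smul_eq_mul, ← hcross]
      ring
    · refine HasDerivAt.congr_deriv (HasFDerivAt.comp_hasDerivAt r (f := fun r' => polX (r', t)) (hD _) (polX_r r t)) ?_
      simp only [map_add, map_smul, ContinuousLinearMap.flip_apply, smul_eq_mul]
      ring
    · refine HasDerivAt.congr_deriv (HasFDerivAt.comp_hasDerivAt t (f := fun t' => polX (r, t')) (hD _) (polX_t r t)) ?_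
      simp only [map_add, map_smul, ContinuousLinearMap.flip_apply, smul_eq_mul]
      ring
    · refine HasDerivAt.congr_deriv (HasFDerivAt.comp_hasDerivAt r (f := fun r' => polX (r', t)) hud.hasFDerivAt
        (polX_r r t)) ?_
      simp only [map_add, map_smul, smul_eq_mul, hev.eq_of_nhds]
      ring
    · rw [← hlap, ← neg_neg (lap u (polX (r, t))), hPDE, norm_polX, abs_of_pos hr.1]
      ring
  · intro r _; simp [polX]
  · intro r _; simp [polX]
  · intro t
    refine hbd _ ?_
    rw [mem_sphere_zero_iff_norm, norm_polX]; simp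
  · intro t
    have hsph : ∀ t', polX (1, t') ∈ sphere (0 : EuclideanSpace ℝ (Fin 2)) 1 := by
      intro t'
      rw [mem_sphere_zero_iff_norm, norm_polX]; simp
    have hw : HasFDerivWithinAt u (fderivWithin ℝ u (closedBall 0 1) (polX (1, t)))
        (closedBall 0 1) (polX (1, t)) :=
      (hreg.differentiableOn (by norm_num) _ (sphere_subset_closedBall (hsph t))).hasFDerivWithinAt
    have h1 := HasFDerivWithinAt.comp_hasDerivAt t (f := fun t' => polX (1, t')) hw (polX_t 1 t)
      (Filter.Eventually.of_forall (fun t' => sphere_subset_closedBall (hsph t')))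
    have h2 : (u ∘ fun t' => polX (1, t')) = fun _ => 0 := by
      ext t'; exact hbd _ (hsph t')
    rw [h2] at h1
    have h3 := h1.unique (hasDerivAt_const t (0:ℝ))
    simp only [map_add, map_smul, smul_eq_mul] at h3
    linear_combination h3
  · simp only [intervalIntegral.integral_const_mul]
    have : ∀ r ∈ Set.uIcc (0:ℝ) 1, ∫ t in (-π)..π, r * (r ^ (2 * α) * exp (2 * u (polX (r, t))))
        = ∫ t in (-π)..π, r * (‖polX (r, t)‖ ^ (2 * α) * exp (2 * u (polX (r, t)))) := by
      intro r hr
      rw [Set.uIcc_of_le zero_le_one] at hr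
      simp only [norm_polX, abs_of_nonneg hr.1]
    have h2 := intervalIntegral.integral_congr (μ := volume) this
    simp only [intervalIntegral.integral_const_mul] at h2 hpol
    rw [h2, hpol]
    field_simp
end
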